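/- With the Frenet hypotheses below, fix s₀ ∈ ℝ, assume k has derivative k′(s₀) at s₀, and let ρ(s) = T(s) + d·k(s)·A_θ(T(s)) (the derivative of the generalized offset r₀). If sin θ ≠ 0, d ≠ 0, k(s₀) = 0 and k′(s₀) ≠ 0, then cross(ρ(s₀), ρ′(s₀)) = d·k′(s₀)·sin θ ≠ 0. In other words, at a regular flex of the curve where the curvature vanishes to first order, the generalized non-classical offset has nonzero signed curvature, so the flex is not preserved. -/

import Mathlib

/-- Rotation of the plane by `π/2`: `J(x,y) = (-y,x)`. -/
def Jrot (v : ℝ × ℝ) : ℝ × ℝ := (-v.2, v.1)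

/-- Rotation of the plane by angle `θ`. -/
noncomputable def rotAngle (θ : ℝ) (v : ℝ × ℝ) : ℝ × ℝ :=
  (v.1 * Real.cos θ - v.2 * Real.sin θ, v.1 * Real.sin θ + v.2 * Real.cos θ)

/-- Planar cross product: `cross((u₁,u₂),(v₁,v₂)) = u₁v₂ − u₂v₁`. -/
def cross (u v : ℝ × ℝ) : ℝ := u.1 * v.2 - u.2 * v.1

theorem HasDerivAt.rotAngle {f : ℝ → ℝ × ℝ} {f' : ℝ × ℝ} {s : ℝ} (θ : ℝ)
    (hf : HasDerivAt f f' s) :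
    HasDerivAt (fun t => rotAngle θ (f t)) (rotAngle θ f') s := by
  have h₁ : HasDerivAt (fun t => (f t).1) f'.1 s :=
    (ContinuousLinearMap.fst ℝ ℝ ℝ).hasFDerivAt.comp_hasDerivAt s hf
  have h₂ : HasDerivAt (fun t => (f t).2) f'.2 s :=
    (ContinuousLinearMap.snd ℝ ℝ ℝ).hasFDerivAt.comp_hasDerivAt s hf
  exact ((h₁.mul_const _).sub (h₂.mul_const _)).prodMk
    ((h₁.mul_const _).add (h₂.mul_const _))

/-- The velocity `ρ = T + d k A_θ(T)` of the generalized offset is differentiable wherever `k` is. -/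
theorem hasDerivAt_generalizedOffset_velocity {T : ℝ → ℝ × ℝ} {k : ℝ → ℝ} {s k' : ℝ} (d θ : ℝ)
    (hT : HasDerivAt T (k s • Jrot (T s)) s) (hk : HasDerivAt k k' s) :
    HasDerivAt (fun t => T t + (d * k t) • rotAngle θ (T t))
      (k s • Jrot (T s) +
        ((d * k s) • rotAngle θ (k s • Jrot (T s)) + (d * k') • rotAngle θ (T s))) s :=
  hT.add ((hk.const_mul d).smul (hT.rotAngle θ))

theorem cross_smul_rotAngle (c θ : ℝ) (v : ℝ × ℝ) :
    cross v (c • rotAngle θ v) = c * Real.sin θ * (v.1 ^ 2 + v.2 ^ 2) := by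
  simp only [cross, rotAngle, Prod.smul_fst, Prod.smul_snd, smul_eq_mul]
  ring

/-- under the Frenet hypotheses, if `sin θ ≠ 0`, `d ≠ 0`, `k(s₀) = 0`
and `k′(s₀) ≠ 0`, then for `ρ(s) = T(s) + d·k(s)·A_θ(T(s))` one has
`cross(ρ(s₀), ρ′(s₀)) = d·k′(s₀)·sin θ ≠ 0`: the generalized non-classical offset
does not preserve a first-order regular flex. -/
theorem generalizedOffset_flex_not_preserved (r T : ℝ → ℝ × ℝ) (k : ℝ → ℝ)
    (hr : ∀ s, HasDerivAt r (T s) s)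
    (hT : ∀ s, (T s).1 ^ 2 + (T s).2 ^ 2 = 1)
    (hF : ∀ s, HasDerivAt T (k s • Jrot (T s)) s)
    (d θ : ℝ) (s₀ k' : ℝ) (hk : HasDerivAt k k' s₀)
    (hθ : Real.sin θ ≠ 0) (hd : d ≠ 0) (hk0 : k s₀ = 0) (hk' : k' ≠ 0) :
    (∀ w : ℝ × ℝ, HasDerivAt (fun s => T s + (d * k s) • rotAngle θ (T s)) w s₀ →
      cross (T s₀ + (d * k s₀) • rotAngle θ (T s₀)) w = d * k' * Real.sin θ) ∧
    d * k' * Real.sin θ ≠ 0 := by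
  refine ⟨fun w hw => ?_, mul_ne_zero (mul_ne_zero hd hk') hθ⟩
  rw [hw.unique (hasDerivAt_generalizedOffset_velocity d θ (hF s₀) hk)]
  simp only [hk0, mul_zero, zero_smul, add_zero, zero_add]
  rw [cross_smul_rotAngle, hT, mul_one]
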